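/- arXiv:2309.06015 — 2 statements merged into one kernel-verified Lean document; each statement's English description precedes it below -/
import Mathlib

section
/- Let d ≥ 2 and let σ : ℝ → ℝ be a Lipschitz function that is not affine, applied componentwise. Let 𝒜 ⊆ ℝ^{d×d} be a set of matrices such that for every l ∈ {1, …, d}, the set { v ∈ ℝ^d : v is the l-th row of some A ∈ 𝒜 } equals ℝ^d. Then the control system with control family 𝓕 = { x ↦ W σ(Ax + b) : W ∈ ℝ^{d×d} diagonal, A ∈ 𝒜, b ∈ ℝ^d } possesses the exact universal interpolation property. In particular, 𝒜 may be taken to be the set of all cyclic (circulant) matrices or the set of all rank-one matrices. -/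
open MeasureTheory

/-- `φ` is the time-`t` flow map of the vector field `f` on `ℝ^d`. -/
def IsFlowMap {d : ℕ} (f : (Fin d → ℝ) → (Fin d → ℝ)) (t : ℝ)
    (φ : (Fin d → ℝ) → (Fin d → ℝ)) : Prop :=
  ∀ x₀ : Fin d → ℝ, ∃ γ : ℝ → (Fin d → ℝ),
    γ 0 = x₀ ∧ γ t = φ x₀ ∧ ∀ s ∈ Set.Icc (0 : ℝ) t, HasDerivAt γ (f (γ s)) s

/-- The attainable set `𝓐_𝓕`. -/
def Attainable {d : ℕ} (F : Set ((Fin d → ℝ) → (Fin d → ℝ))) :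
    Set ((Fin d → ℝ) → (Fin d → ℝ)) :=
  { φ | ∃ (k : ℕ), 0 < k ∧ ∃ (f : Fin k → ((Fin d → ℝ) → (Fin d → ℝ)))
      (t : Fin k → ℝ) (φs : Fin k → ((Fin d → ℝ) → (Fin d → ℝ))),
      (∀ i, f i ∈ F) ∧ (∀ i, 0 ≤ t i) ∧ (∀ i, IsFlowMap (f i) (t i) (φs i)) ∧
      φ = (List.ofFn φs).foldr (· ∘ ·) id }

/-- Exact universal interpolation property. -/
def ExactUIP {d : ℕ} (F : Set ((Fin d → ℝ) → (Fin d → ℝ))) : Prop :=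
  ∀ (N : ℕ) (x y : Fin N → (Fin d → ℝ)),
    Function.Injective x → Function.Injective y →
    ∃ φ ∈ Attainable F, ∀ i, φ (x i) = y i

/-- The ResNet-type family with diagonal outer weight and inner matrices from `𝒜`. -/
def WeakResNetFamily (d : ℕ) (σ : ℝ → ℝ) (𝒜 : Set (Matrix (Fin d) (Fin d) ℝ)) :
    Set ((Fin d → ℝ) → (Fin d → ℝ)) :=
  { f | ∃ (W A : Matrix (Fin d) (Fin d) ℝ) (b : Fin d → ℝ),
      W.IsDiag ∧ A ∈ 𝒜 ∧ f = fun x => W.mulVec (fun i => σ (A.mulVec x i + b i)) }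

/-- The set of circulant matrices. -/
def CirculantMatrices (d : ℕ) : Set (Matrix (Fin d) (Fin d) ℝ) :=
  { M | ∃ w : Fin d → ℝ, M = Matrix.circulant w }

/-- The set of rank-one matrices. -/
def RankOneMatrices (d : ℕ) : Set (Matrix (Fin d) (Fin d) ℝ) :=
  { M | M.rank = 1 }

/-- All `n`-fold iterated finite differences of `g` vanish. -/
def FiniteDiffVanish : ℕ → (ℝ → ℝ) → Prop
  | 0, g => ∀ x, g x = 0
  | n + 1, g => ∀ h, FiniteDiffVanish n (fun x => g (x + h) - g x)

lemma FiniteDiffVanish.const_of_bounded {n : ℕ} {g : ℝ → ℝ} (hg : FiniteDiffVanish n g)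
    (hb : ∃ C, ∀ x, |g x| ≤ C) (x y : ℝ) : g x = g y := by
  induction n generalizing g x y with
  | zero => rw [hg x, hg y]
  | succ n ih =>
    obtain ⟨C, hC⟩ := hb
    set h := y - x with hh
    have hconst : ∀ u, g (u + h) - g u = g (x + h) - g x := fun u =>
      ih (hg h) ⟨C + C, fun z => (abs_sub _ _).trans (add_le_add (hC _) (hC _))⟩ u x
    have hiter : ∀ k : ℕ, g (x + k * h) = g x + k * (g y - g x) := by
      intro k
      induction k with
      | zero => simp
      | succ k ihk =>
        have := hconst (x + k * h)
        have e1 : x + k * h + h = x + (k + 1 : ℕ) * h := by push_cast; ring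
        have e2 : x + h = y := by rw [hh]; ring
        rw [e1, e2, ihk] at this
        push_cast at this ⊢
        linarith
    by_contra hne
    have hpos : 0 < |g y - g x| := abs_pos.mpr (sub_ne_zero.mpr (Ne.symm hne))
    obtain ⟨k, hk⟩ := exists_nat_gt ((C + C) / |g y - g x|)
    rw [div_lt_iff₀ hpos] at hk
    have h1 : (k : ℝ) * (g y - g x) = g (x + k * h) - g x := by rw [hiter]; ring
    have h2 : (k : ℝ) * |g y - g x| = |g (x + k * h) - g x| := by
      rw [← h1, abs_mul, Nat.abs_cast]
    have h3 := (abs_sub (g (x + k * h)) (g x)).trans (add_le_add (hC _) (hC _))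
    linarith

lemma FiniteDiffVanish.affine_of_lipschitz {n : ℕ} {g : ℝ → ℝ} (hg : FiniteDiffVanish n g)
    {L : NNReal} (hL : LipschitzWith L g) : ∃ a c : ℝ, ∀ x, g x = a * x + c := by
  have hadd : ∀ x h, g (x + h) - g x = g h - g 0 := by
    cases n with
    | zero => intro x h; simp [hg _]
    | succ n =>
      intro x h
      have := (hg h).const_of_bounded ⟨L * |h|, fun z => by
        have := hL.dist_le_mul (z + h) z
        simpa [Real.dist_eq] using this⟩ x 0
      simpa using this
  let τ : ℝ →+ ℝ := AddMonoidHom.mk' (fun x => g x - g 0) (fun x y => by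
    have := hadd x y
    linarith)
  have hτ : Continuous τ := hL.continuous.sub continuous_const
  refine ⟨g 1 - g 0, g 0, fun x => ?_⟩
  have h1 : τ (x • (1 : ℝ)) = x • τ 1 := map_real_smul τ hτ x 1
  have h2 : g x - g 0 = x * (g 1 - g 0) := by simpa [τ] using h1
  linarith

lemma finiteDiffVanish_of_sum_eq_zero (s : Finset ℝ) {t₀ : ℝ} (ht₀ : t₀ ∉ s) (G : ℝ → ℝ → ℝ)
    (hG : ∀ a b, G t₀ (a * t₀ + b) + ∑ t ∈ s, G t (a * t + b) = 0) :
    FiniteDiffVanish s.card (G t₀) := by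
  induction s using Finset.induction_on generalizing G with
  | empty => intro x; simpa using hG 0 x
  | insert t₁ s ht₁ ih =>
    rw [Finset.card_insert_of_notMem ht₁]
    intro h
    rw [Finset.mem_insert, not_or] at ht₀
    have hne : t₀ - t₁ ≠ 0 := sub_ne_zero.mpr ht₀.1
    set r := h / (t₀ - t₁) with hr
    have hrh : r * (t₀ - t₁) = h := div_mul_cancel₀ _ hne
    have key := ih ht₀.2 (fun t x => G t (x + r * (t - t₁)) - G t x) (fun a b => by
      have h1 := hG a b
      have h2 := hG (a + r) (b - r * t₁)
      rw [Finset.sum_insert ht₁] at h1 h2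
      have e : ∀ t, (a + r) * t + (b - r * t₁) = a * t + b + r * (t - t₁) := fun t => by ring
      simp only [e, sub_self, mul_zero, add_zero] at h2
      rw [Finset.sum_sub_distrib]
      linarith)
    simpa only [hrh] using key

/-- The span of the one-dimensional ridge functions `t ↦ σ (a * t + b)`. -/
def ridgeSpan (σ : ℝ → ℝ) : Submodule ℝ (ℝ → ℝ) :=
  Submodule.span ℝ (Set.range fun p : ℝ × ℝ => fun t => σ (p.1 * t + p.2))

/-- Lipschitz non-affine activations interpolate arbitrary data on finite subsets of `ℝ`. -/
lemma exists_mem_ridgeSpan_eqOn {σ : ℝ → ℝ} (hLip : ∃ L : NNReal, LipschitzWith L σ)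
    (hNonAffine : ¬ ∃ (a c : ℝ), ∀ x : ℝ, σ x = a * x + c) (T : Finset ℝ) (g : ℝ → ℝ) :
    ∃ h ∈ ridgeSpan σ, ∀ t ∈ T, h t = g t := by
  let res : (ℝ → ℝ) →ₗ[ℝ] (T → ℝ) := LinearMap.funLeft ℝ ℝ Subtype.val
  suffices htop : (ridgeSpan σ).map res = ⊤ by
    have hmem : res g ∈ (ridgeSpan σ).map res := htop ▸ Submodule.mem_top
    obtain ⟨h, hh, he⟩ := hmem
    exact ⟨h, hh, fun t ht => congrFun he ⟨t, ht⟩⟩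
  by_contra hne
  obtain ⟨φ, hφ, hle⟩ := Submodule.exists_le_ker_of_lt_top _ (lt_top_iff_ne_top.mpr hne)
  classical
  let c : ℝ → ℝ := fun t => if ht : t ∈ T then φ (Pi.single ⟨t, ht⟩ 1) else 0
  have hφc : ∀ u : ℝ → ℝ, φ (res u) = ∑ t ∈ T, c t * u t := by
    intro u
    rw [LinearMap.pi_apply_eq_sum_univ φ, ← Finset.sum_attach T]
    refine Finset.sum_congr rfl fun t _ => ?_
    have e : (fun j => if t = j then (1 : ℝ) else 0) = Pi.single t 1 := by
      ext j; simp [Pi.single_apply, eq_comm]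
    simp [c, res, LinearMap.funLeft_apply, mul_comm, e]
  obtain ⟨t₀, ht₀, hc₀⟩ : ∃ t₀ ∈ T, c t₀ ≠ 0 := by
    by_contra! hc
    refine hφ (LinearMap.ext fun u => ?_)
    have hu : res (Function.extend Subtype.val u 0) = u := by
      ext t
      exact Subtype.val_injective.extend_apply u 0 t
    rw [← hu, hφc, Finset.sum_eq_zero fun t ht => by rw [hc t ht, zero_mul]]
    rfl
  have hzero : ∀ a b, ∑ t ∈ T, c t * σ (a * t + b) = 0 := by
    intro a b
    rw [← hφc fun t => σ (a * t + b)]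
    exact hle (Submodule.mem_map_of_mem (Submodule.subset_span ⟨(a, b), rfl⟩))
  have hvan := finiteDiffVanish_of_sum_eq_zero (T.erase t₀) (Finset.notMem_erase t₀ T)
    (fun t x => c t / c t₀ * σ x) (fun a b => by
      rw [Finset.add_sum_erase T (fun t => c t / c t₀ * σ (a * t + b)) ht₀]
      simp_rw [div_mul_eq_mul_div]
      rw [← Finset.sum_div, hzero, zero_div])
  simp only [div_self hc₀, one_mul] at hvan
  obtain ⟨L, hL⟩ := hLip
  exact hNonAffine (hvan.affine_of_lipschitz hL)

/-- Some attainable map sends each `x i` to `y i`. -/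
def Steers {d N : ℕ} (F : Set ((Fin d → ℝ) → (Fin d → ℝ))) (x y : Fin N → (Fin d → ℝ)) : Prop :=
  ∃ φ ∈ Attainable F, ∀ i, φ (x i) = y i

lemma comp_mem_attainable {d : ℕ} {F : Set ((Fin d → ℝ) → (Fin d → ℝ))}
    {φ ψ : (Fin d → ℝ) → (Fin d → ℝ)} (hφ : φ ∈ Attainable F) (hψ : ψ ∈ Attainable F) :
    φ ∘ ψ ∈ Attainable F := by
  obtain ⟨k, hk, f, t, φs, hf, ht, hφs, rfl⟩ := hφ
  obtain ⟨k', -, f', t', φs', hf', ht', hφs', rfl⟩ := hψ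
  have hfold : ∀ (l : List ((Fin d → ℝ) → (Fin d → ℝ))) (χ : (Fin d → ℝ) → (Fin d → ℝ)),
      l.foldr (· ∘ ·) χ = l.foldr (· ∘ ·) id ∘ χ := by
    intro l χ
    induction l with
    | nil => rfl
    | cons a l ih => simp only [List.foldr_cons, ih, Function.comp_assoc]
  refine ⟨k + k', by omega, Fin.append f f', Fin.append t t', Fin.append φs φs', ?_, ?_, ?_, ?_⟩
  · intro i
    refine Fin.addCases (fun i => ?_) (fun i => ?_) i <;> simp [hf, hf']
  · intro i
    refine Fin.addCases (fun i => ?_) (fun i => ?_) i <;> simp [ht, ht']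
  · intro i
    refine Fin.addCases (fun i => ?_) (fun i => ?_) i <;> simp [hφs, hφs']
  · rw [List.ofFn_fin_append, List.foldr_append]
    exact (hfold _ _).symm

lemma Steers.trans {d N : ℕ} {F : Set ((Fin d → ℝ) → (Fin d → ℝ))} {x y z : Fin N → (Fin d → ℝ)}
    (hxy : Steers F x y) (hyz : Steers F y z) : Steers F x z := by
  obtain ⟨φ, hφ, hφx⟩ := hxy
  obtain ⟨ψ, hψ, hψy⟩ := hyz
  exact ⟨ψ ∘ φ, comp_mem_attainable hψ hφ, fun i => by simp [hφx, hψy]⟩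

/-- The flow of a field that is constant along its own trajectories. -/
lemma IsFlowMap.of_invariant {d : ℕ} {f : (Fin d → ℝ) → (Fin d → ℝ)}
    (hf : ∀ x (s : ℝ), f (x + s • f x) = f x) : IsFlowMap f 1 (fun x => x + f x) := by
  intro x
  refine ⟨fun s => x + s • f x, by simp, by simp, fun s _ => ?_⟩
  rw [hf]
  simpa using ((hasDerivAt_id s).smul_const (f x)).const_add x

section Shears

variable {d : ℕ} {σ : ℝ → ℝ} {𝒜 : Set (Matrix (Fin d) (Fin d) ℝ)}

lemma attainable_ridge_shear
    (hrows : ∀ l : Fin d, {v : Fin d → ℝ | ∃ A ∈ 𝒜, A l = v} = Set.univ)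
    {l m : Fin d} (hlm : m ≠ l) (w a b : ℝ) :
    (fun x => x + Pi.single l (w * σ (a * x m + b))) ∈ Attainable (WeakResNetFamily d σ 𝒜) := by
  have hA : Pi.single m a ∈ {v : Fin d → ℝ | ∃ A ∈ 𝒜, A l = v} := hrows l ▸ Set.mem_univ _
  obtain ⟨A, hA, hAl⟩ := hA
  set f : (Fin d → ℝ) → (Fin d → ℝ) := fun x => Pi.single l (w * σ (a * x m + b)) with hf
  have hmem : f ∈ WeakResNetFamily d σ 𝒜 := by
    refine ⟨Matrix.diagonal (Pi.single l w), A, fun _ => b, Matrix.isDiag_diagonal _, hA, ?_⟩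
    funext x j
    rw [Matrix.mulVec_diagonal]
    rcases eq_or_ne j l with rfl | hj
    · simp [hf, Matrix.mulVec, hAl]
    · simp [hf, hj]
  refine ⟨1, one_pos, fun _ => f, fun _ => 1, fun _ x => x + f x, fun _ => hmem,
    fun _ => zero_le_one, fun _ => IsFlowMap.of_invariant fun x s => ?_, by simp [hf]⟩
  simp [hf, hlm]

lemma attainable_shear_of_mem_ridgeSpan
    (hrows : ∀ l : Fin d, {v : Fin d → ℝ | ∃ A ∈ 𝒜, A l = v} = Set.univ)
    {l m : Fin d} (hlm : m ≠ l) {g : ℝ → ℝ} (hg : g ∈ ridgeSpan σ) :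
    (fun x => x + Pi.single l (g (x m))) ∈ Attainable (WeakResNetFamily d σ 𝒜) := by
  suffices H : ∀ w : ℝ, (fun x => x + Pi.single l (w * g (x m))) ∈
      Attainable (WeakResNetFamily d σ 𝒜) by simpa using H 1
  induction hg using Submodule.span_induction with
  | mem g hg =>
    obtain ⟨p, rfl⟩ := hg
    exact fun w => attainable_ridge_shear hrows hlm w p.1 p.2
  | zero => intro w; simpa using attainable_ridge_shear (σ := σ) hrows hlm 0 0 0
  | add g h _ _ ihg ihh =>
    intro w
    convert comp_mem_attainable (ihg w) (ihh w) using 1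
    funext x
    simp [hlm, mul_add, Pi.single_add, add_comm, add_left_comm]
  | smul c g _ ih =>
    intro w
    simpa [mul_assoc] using ih (w * c)

end Shears

/-- Any coordinate of a finite configuration can be shifted by any function of another one. -/
def ShearControllable {d : ℕ} (F : Set ((Fin d → ℝ) → (Fin d → ℝ))) : Prop :=
  ∀ (N : ℕ) (x : Fin N → (Fin d → ℝ)) (l m : Fin d), m ≠ l → ∀ g : ℝ → ℝ,
    Steers F x (fun i => x i + Pi.single l (g (x i m)))

lemma shearControllable_weakResNetFamily {d : ℕ} {σ : ℝ → ℝ}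
    {𝒜 : Set (Matrix (Fin d) (Fin d) ℝ)} (hLip : ∃ L : NNReal, LipschitzWith L σ)
    (hNonAffine : ¬ ∃ (a c : ℝ), ∀ x : ℝ, σ x = a * x + c)
    (hrows : ∀ l : Fin d, {v : Fin d → ℝ | ∃ A ∈ 𝒜, A l = v} = Set.univ) :
    ShearControllable (WeakResNetFamily d σ 𝒜) := by
  intro N x l m hlm g
  obtain ⟨h, hh, he⟩ := exists_mem_ridgeSpan_eqOn hLip hNonAffine
    (Finset.univ.image fun i => x i m) g
  refine ⟨_, attainable_shear_of_mem_ridgeSpan hrows hlm hh, fun i => ?_⟩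
  simp only [he _ (Finset.mem_image_of_mem _ (Finset.mem_univ i))]

namespace ShearControllable

variable {d N : ℕ} {F : Set ((Fin d → ℝ) → (Fin d → ℝ))}

lemma steers_update (hF : ShearControllable F) {x : Fin N → (Fin d → ℝ)} {l m : Fin d}
    (hlm : m ≠ l) (hx : Function.Injective fun i => x i m) (z : Fin N → ℝ) :
    Steers F x (fun i => Function.update (x i) l (z i)) := by
  convert hF N x l m hlm (Function.extend (fun i => x i m) (fun i => z i - x i l) 0) using 1
  funext i j
  have hext := hx.extend_apply (fun i => z i - x i l) 0 i
  rw [Pi.add_apply, hext]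
  rcases eq_or_ne j l with rfl | hj
  · simp
  · simp [hj]

lemma steers_self (hF : ShearControllable F) {l m : Fin d} (hlm : m ≠ l)
    (x : Fin N → (Fin d → ℝ)) : Steers F x x := by
  simpa using hF N x l m hlm 0

lemma steers_of_eq_coord (hF : ShearControllable F) {l m : Fin d} (hlm : m ≠ l)
    {x y : Fin N → (Fin d → ℝ)} (hx : Function.Injective fun i => x i m)
    (hxy : ∀ i, y i m = x i m) : Steers F x y := by
  classical
  suffices H : ∀ s : Finset (Fin d), Steers F x (fun i j => if j ∈ s then y i j else x i j) by
    simpa using H Finset.univ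
  intro s
  induction s using Finset.induction_on with
  | empty => simpa using hF.steers_self hlm x
  | insert k s hk ih =>
    rcases eq_or_ne m k with rfl | hmk
    · convert ih using 3 with i j
      rcases eq_or_ne j m with rfl | hj
      · simp [hk, hxy]
      · simp [hj]
    · have hinj : Function.Injective fun i => if m ∈ s then y i m else x i m := by
        simpa [hxy] using hx
      refine ih.trans ?_
      convert hF.steers_update
        (x := fun i j => if j ∈ s then y i j else x i j) hmk hinj (fun i => y i k) using 3 with i j
      rcases eq_or_ne j k with rfl | hj
      · simp
      · simp [hj]

lemma steers_add_linear (hF : ShearControllable F) {l m : Fin d} (hlm : m ≠ l)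
    (x : Fin N → (Fin d → ℝ)) (c : Fin d → ℝ) (s : Finset (Fin d)) (hs : l ∉ s) :
    Steers F x (fun i => x i + Pi.single l (∑ k ∈ s, c k * x i k)) := by
  induction s using Finset.induction_on with
  | empty => simpa using hF.steers_self hlm x
  | insert k s hk ih =>
    rw [Finset.mem_insert, not_or] at hs
    have hkl : k ≠ l := Ne.symm hs.1
    refine (ih hs.2).trans ?_
    convert hF N _ l k hkl (fun t => c k * t) using 1
    funext i
    rw [Finset.sum_insert hk, add_assoc, ← Pi.single_add]
    simp [hkl, add_comm]

end ShearControllable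

/-- Finitely many distinct points are separated by a functional `x 0 + ∑ c k * x k`. -/
lemma exists_linear_injective {d N : ℕ} [NeZero d] {x : Fin N → (Fin d → ℝ)}
    (hx : Function.Injective x) : ∃ c : Fin d → ℝ, c 0 = 1 ∧
      Function.Injective fun i => ∑ k, c k * x i k := by
  classical
  let p : Fin N × Fin N → Polynomial ℝ := fun q =>
    ∑ k : Fin d, Polynomial.monomial (k : ℕ) (x q.1 k - x q.2 k)
  have hp : ∀ q ∈ (Finset.univ : Finset (Fin N)).offDiag, p q ≠ 0 := by
    intro q hq h0
    refine (Finset.mem_offDiag.mp hq).2.2 (hx (funext fun k => sub_eq_zero.mp ?_))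
    have := congrArg (fun r => Polynomial.coeff r (k : ℕ)) h0
    simpa [p, Polynomial.finsetSum_coeff, Polynomial.coeff_monomial, Fin.val_inj] using this
  have hprod : ∏ q ∈ (Finset.univ : Finset (Fin N)).offDiag, p q ≠ 0 :=
    Finset.prod_ne_zero_iff.mpr hp
  obtain ⟨s, hs⟩ : ∃ s, (∏ q ∈ (Finset.univ : Finset (Fin N)).offDiag, p q).eval s ≠ 0 := by
    by_contra! h
    exact hprod (Polynomial.funext (by simpa using h))
  rw [Polynomial.eval_prod, Finset.prod_ne_zero_iff] at hs
  refine ⟨fun k => s ^ (k : ℕ), by simp, fun i j hij => ?_⟩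
  by_contra hne
  refine hs (i, j) (by simpa using hne) ?_
  simp only [p, Polynomial.eval_finsetSum, Polynomial.eval_monomial, sub_mul,
    Finset.sum_sub_distrib, sub_eq_zero]
  simpa only [mul_comm] using hij

namespace ShearControllable

variable {d N : ℕ} {F : Set ((Fin d → ℝ) → (Fin d → ℝ))}

lemma exists_steers_injective_coord [NeZero d] (hF : ShearControllable F) {m : Fin d}
    (hm : m ≠ 0) {x : Fin N → (Fin d → ℝ)} (hx : Function.Injective x) :
    ∃ x' : Fin N → (Fin d → ℝ), Steers F x x' ∧ Steers F x' x ∧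
      Function.Injective fun i => x' i 0 := by
  obtain ⟨c, hc, hinj⟩ := exists_linear_injective hx
  set s : Finset (Fin d) := Finset.univ.erase 0 with hs
  have h0 : (0 : Fin d) ∉ s := Finset.notMem_erase _ _
  refine ⟨fun i => x i + Pi.single 0 (∑ k ∈ s, c k * x i k),
    hF.steers_add_linear hm x c s h0, ?_, ?_⟩
  · convert hF.steers_add_linear hm _ (-c) s h0 using 1
    funext i
    have hsum : ∀ u : ℝ, ∑ k ∈ s, (-c) k * (x i + Pi.single 0 u : Fin d → ℝ) k = -∑ k ∈ s, c k * x i k := by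
      intro u
      rw [← Finset.sum_neg_distrib]
      refine Finset.sum_congr rfl fun k hk => ?_
      have hk0 : k ≠ 0 := Finset.ne_of_mem_erase hk
      simp [hk0]
    rw [hsum, add_assoc, ← Pi.single_add]
    simp
  · convert hinj using 2 with i
    rw [← Finset.add_sum_erase _ _ (Finset.mem_univ (0 : Fin d)), hc]
    simp [hs]

/-- Shear controllability in dimension at least two implies exact universal interpolation. -/
theorem exactUIP (hd : 2 ≤ d) (hF : ShearControllable F) : ExactUIP F := by
  intro N x y hx hy
  have : NeZero d := ⟨by omega⟩
  obtain ⟨m, hm⟩ : ∃ m : Fin d, m ≠ 0 := by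
    have : Nontrivial (Fin d) := Fin.nontrivial_iff_two_le.mpr hd
    exact exists_ne 0
  obtain ⟨x', hxx', -, hx'⟩ := hF.exists_steers_injective_coord hm hx
  obtain ⟨y', -, hy'y, hy'⟩ := hF.exists_steers_injective_coord hm hy
  have hsep := hF.steers_update (Ne.symm hm) hx' (fun i => (i : ℝ))
  have hcoord := hF.steers_update (x := fun i => Function.update (x' i) m (i : ℝ)) hm
    (by intro i j h; simpa [Fin.val_inj] using h) (fun i => y' i 0)
  refine hxx'.trans (hsep.trans (hcoord.trans (Steers.trans ?_ hy'y)))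
  exact hF.steers_of_eq_coord (Ne.symm hm) (by simpa using hy') (by simp)

end ShearControllable

lemma circulant_rows_eq_univ {d : ℕ} (l : Fin d) :
    {v : Fin d → ℝ | ∃ A ∈ CirculantMatrices d, A l = v} = Set.univ := by
  have : NeZero d := ⟨by have := l.isLt; omega⟩
  refine Set.eq_univ_of_forall fun v => ⟨_, ⟨fun k => v (l - k), rfl⟩, ?_⟩
  funext j
  simp [Matrix.circulant]

lemma rankOne_rows_eq_univ {d : ℕ} (hd : 2 ≤ d) (l : Fin d) :
    {v : Fin d → ℝ | ∃ A ∈ RankOneMatrices d, A l = v} = Set.univ := by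
  have : Nontrivial (Fin d) := Fin.nontrivial_iff_two_le.mpr hd
  have rank_eq_one : ∀ (u v : Fin d → ℝ) (i : Fin d), u i = 1 → v ≠ 0 →
      (Matrix.vecMulVec u v).rank = 1 := by
    intro u v i hu hv
    refine le_antisymm (Matrix.rank_vecMulVec_le u v) (Nat.one_le_iff_ne_zero.mpr fun h0 => hv ?_)
    rw [Matrix.rank, Submodule.finrank_eq_zero, LinearMap.range_eq_bot] at h0
    funext j
    simpa [Matrix.vecMulVec_apply, hu] using congrFun (LinearMap.congr_fun h0 (Pi.single j 1)) i
  refine Set.eq_univ_of_forall fun v => ?_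
  by_cases hv : v = 0
  · obtain ⟨i, hi⟩ := exists_ne l
    refine ⟨Matrix.vecMulVec (Pi.single i 1) 1, rank_eq_one _ _ i (by simp) ?_, ?_⟩
    · exact fun h => one_ne_zero (congrFun h l)
    · funext j
      simp [Matrix.vecMulVec_apply, hi.symm, hv]
  · refine ⟨Matrix.vecMulVec 1 v, rank_eq_one _ _ l rfl hv, ?_⟩
    funext j
    simp [Matrix.vecMulVec_apply]

/-- UIP for ResNets with diagonal outer weights and constrained inner matrices whose
`l`-th rows fill all of `ℝ^d`, for each `l`.  In particular, the row condition holds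
for the circulant matrices and for the rank-one matrices. -/
theorem weak_resnet_exact_uip {d : ℕ} (hd : 2 ≤ d) (σ : ℝ → ℝ)
    (hLip : ∃ L : NNReal, LipschitzWith L σ)
    (hNonAffine : ¬ ∃ (a c : ℝ), ∀ x : ℝ, σ x = a * x + c)
    (𝒜 : Set (Matrix (Fin d) (Fin d) ℝ))
    (hrows : ∀ l : Fin d, {v : Fin d → ℝ | ∃ A ∈ 𝒜, A l = v} = Set.univ) :
    ExactUIP (WeakResNetFamily d σ 𝒜) ∧
      (∀ l : Fin d, {v : Fin d → ℝ | ∃ A ∈ CirculantMatrices d, A l = v} = Set.univ) ∧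
      (∀ l : Fin d, {v : Fin d → ℝ | ∃ A ∈ RankOneMatrices d, A l = v} = Set.univ) := by
  exact ⟨(shearControllable_weakResNetFamily hLip hNonAffine hrows).exactUIP hd,
    circulant_rows_eq_univ, rankOne_rows_eq_univ hd⟩
end

section
/- Let d ≥ 2 and let 𝓕 be a family of globally Lipschitz vector fields on ℝ^d whose control system possesses the universal interpolation property (for every ε > 0, every N, all pairwise distinct x_1, …, x_N and pairwise distinct y_1, …, y_N in ℝ^d, there is φ ∈ 𝓐_𝓕 with ‖φ(x_i) − y_i‖_∞ ≤ ε for all i). Suppose moreover that for every compact set K ⊆ ℝ^d, every increasing continuous function h : ℝ → ℝ and every ε > 0, there exists φ ∈ 𝓐_𝓕 with sup_{x ∈ K} ‖φ(x) − (h(x_1), …, h(x_d))‖ < ε. Then for every 1 ≤ p < ∞ the system possesses the universal approximation property in the L^p sense: for every continuous F : ℝ^d → ℝ^d, every compact K ⊆ ℝ^d and every ε > 0, there exists φ ∈ 𝓐_𝓕 with ‖F − φ‖_{L^p(K)} < ε. -/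
open MeasureTheory

open Set Filter Topology

section FlowMap

variable {d : ℕ} {F : Set ((Fin d → ℝ) → (Fin d → ℝ))}

theorem IsFlowMap.continuous {f : (Fin d → ℝ) → (Fin d → ℝ)} {L : NNReal}
    (hf : LipschitzWith L f) {t : ℝ} (ht : 0 ≤ t) {φ : (Fin d → ℝ) → (Fin d → ℝ)}
    (hφ : IsFlowMap f t φ) : Continuous φ := by
  have key : LipschitzWith (Real.exp (L * t)).toNNReal φ := by
    refine LipschitzWith.of_dist_le_mul fun x y => ?_
    obtain ⟨a, ha0, hat, ha⟩ := hφ x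
    obtain ⟨b, hb0, hbt, hb⟩ := hφ y
    have h := dist_le_of_trajectories_ODE (v := fun _ => f) (K := L) (f := a) (g := b)
      (δ := dist x y) (a := 0) (b := t) (fun _ => hf)
      (fun s hs => (ha s hs).continuousAt.continuousWithinAt)
      (fun s hs => (ha s (Ico_subset_Icc_self hs)).hasDerivWithinAt)
      (fun s hs => (hb s hs).continuousAt.continuousWithinAt)
      (fun s hs => (hb s (Ico_subset_Icc_self hs)).hasDerivWithinAt)
      (by rw [ha0, hb0]) t (right_mem_Icc.2 ht)
    rw [hat, hbt, sub_zero] at h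
    rw [Real.coe_toNNReal _ (Real.exp_pos _).le, mul_comm]
    exact h
  exact key.continuous

theorem mem_attainable_iff_list {φ : (Fin d → ℝ) → (Fin d → ℝ)} :
    φ ∈ Attainable F ↔ ∃ l : List ((Fin d → ℝ) → (Fin d → ℝ)), l ≠ [] ∧
      (∀ g ∈ l, ∃ f ∈ F, ∃ t : ℝ, 0 ≤ t ∧ IsFlowMap f t g) ∧ φ = l.foldr (· ∘ ·) id := by
  constructor
  · rintro ⟨k, hk, f, t, φs, hf, ht, hfl, rfl⟩
    refine ⟨List.ofFn φs, ?_, ?_, rfl⟩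
    · simpa [List.ofFn_eq_nil_iff] using hk.ne'
    · intro g hg
      obtain ⟨i, rfl⟩ := (List.mem_ofFn' _ _).1 hg
      exact ⟨f i, hf i, t i, ht i, hfl i⟩
  · rintro ⟨l, hl, h, rfl⟩
    choose f hf t ht hfl using fun i : Fin l.length => h (l.get i) (l.get_mem i)
    exact ⟨l.length, List.length_pos_iff.2 hl, f, t, l.get, hf, ht, hfl, by rw [List.ofFn_get]⟩

theorem foldr_comp_append {α : Type*} (l₁ l₂ : List (α → α)) :
    (l₁ ++ l₂).foldr (· ∘ ·) id = l₁.foldr (· ∘ ·) id ∘ l₂.foldr (· ∘ ·) id := by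
  induction l₁ with
  | nil => rfl
  | cons g l ih => simp only [List.cons_append, List.foldr_cons, ih, Function.comp_assoc]

theorem Attainable.comp {φ ψ : (Fin d → ℝ) → (Fin d → ℝ)} (hφ : φ ∈ Attainable F)
    (hψ : ψ ∈ Attainable F) : φ ∘ ψ ∈ Attainable F := by
  obtain ⟨l₁, hne, h₁, rfl⟩ := mem_attainable_iff_list.1 hφ
  obtain ⟨l₂, -, h₂, rfl⟩ := mem_attainable_iff_list.1 hψ
  refine mem_attainable_iff_list.2 ⟨l₁ ++ l₂, by simp [hne], fun g hg => ?_,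
    (foldr_comp_append l₁ l₂).symm⟩
  exact (List.mem_append.1 hg).elim (h₁ g) (h₂ g)

theorem Attainable.continuous (hLip : ∀ f ∈ F, ∃ L : NNReal, LipschitzWith L f)
    {φ : (Fin d → ℝ) → (Fin d → ℝ)} (hφ : φ ∈ Attainable F) : Continuous φ := by
  obtain ⟨l, -, h, rfl⟩ := mem_attainable_iff_list.1 hφ
  have hc : ∀ g ∈ l, Continuous g := fun g hg => by
    obtain ⟨f, hf, t, ht, hfl⟩ := h g hg
    obtain ⟨L, hL⟩ := hLip f hf
    exact hfl.continuous hL ht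
  clear h hφ
  induction l with
  | nil => exact continuous_id
  | cons g l ih =>
    exact (hc g List.mem_cons_self).comp (ih fun g' hg' => hc g' (List.mem_cons_of_mem _ hg'))

end FlowMap

/-- In a space without isolated points a finite family can be perturbed to be injective. -/
theorem exists_injective_dist_le {X ι : Type*} [MetricSpace X] [∀ x : X, NeBot (𝓝[≠] x)]
    [Fintype ι] (z : ι → X) {ε : ℝ} (hε : 0 < ε) :
    ∃ y : ι → X, Function.Injective y ∧ ∀ i, dist (y i) (z i) ≤ ε := by
  classical
  choose t hts htc using fun i => (infinite_of_mem_nhds (z i)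
    (Metric.closedBall_mem_nhds (z i) hε)).exists_subset_card_eq (Fintype.card ι)
  obtain ⟨y, hy, hyt⟩ := (Finset.all_card_le_biUnion_card_iff_exists_injective t).1 fun s => by
    rcases s.eq_empty_or_nonempty with rfl | ⟨i, hi⟩
    · simp
    · exact (Finset.card_le_univ s).trans
        ((htc i).symm.le.trans (Finset.card_le_card (Finset.subset_biUnion_of_mem t hi)))
  exact ⟨y, hy, fun i => hts i (hyt i)⟩

/-- A monotone continuous approximation `⌊u⌋ + (fract u) ^ (n + 1)` of the floor function, at
scale `δ`. -/
noncomputable def smoothFloor (δ : ℝ) (n : ℕ) (x : ℝ) : ℝ :=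
  δ * (⌊x / δ⌋ + Int.fract (x / δ) ^ (n + 1))

theorem smoothFloor_monotone {δ : ℝ} (hδ : 0 < δ) (n : ℕ) : Monotone (smoothFloor δ n) := by
  intro x y hxy
  have huv : x / δ ≤ y / δ := by gcongr
  unfold smoothFloor
  refine mul_le_mul_of_nonneg_left ?_ hδ.le
  rcases (Int.floor_mono huv).eq_or_lt with h | h
  · have hf : Int.fract (x / δ) ≤ Int.fract (y / δ) := by
      rw [← Int.self_sub_floor, ← Int.self_sub_floor, h]
      linarith
    rw [h]
    gcongr
  · have h1 : (⌊x / δ⌋ : ℝ) + 1 ≤ ⌊y / δ⌋ := by exact_mod_cast h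
    have h2 : Int.fract (x / δ) ^ (n + 1) ≤ 1 :=
      pow_le_one₀ (Int.fract_nonneg _) (Int.fract_lt_one _).le
    have h3 : 0 ≤ Int.fract (y / δ) ^ (n + 1) := pow_nonneg (Int.fract_nonneg _) _
    linarith

theorem smoothFloor_continuous (δ : ℝ) (n : ℕ) : Continuous (smoothFloor δ n) := by
  have hg : Continuous ((fun s : ℝ => s ^ (n + 1) - s) ∘ Int.fract) :=
    ContinuousOn.comp_fract'' (by fun_prop) (by simp)
  have h : smoothFloor δ n =
      fun x => δ * (x / δ + ((fun s : ℝ => s ^ (n + 1) - s) ∘ Int.fract) (x / δ)) := by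
    funext x
    simp only [smoothFloor, Function.comp_apply]
    linear_combination δ * Int.floor_add_fract (x / δ)
  rw [h]
  exact continuous_const.mul
    ((continuous_id.div_const δ).add (hg.comp (continuous_id.div_const δ)))

theorem abs_smoothFloor_sub_le {δ : ℝ} (hδ : 0 < δ) (n : ℕ) (x : ℝ) :
    |smoothFloor δ n x - x| ≤ δ := by
  have h0 := Int.fract_nonneg (x / δ)
  have h1 := (Int.fract_lt_one (x / δ)).le
  have h2 : Int.fract (x / δ) ^ (n + 1) ≤ 1 := pow_le_one₀ h0 h1
  have h3 : 0 ≤ Int.fract (x / δ) ^ (n + 1) := pow_nonneg h0 _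
  have h : smoothFloor δ n x - x = δ * (Int.fract (x / δ) ^ (n + 1) - Int.fract (x / δ)) := by
    have hx : δ * (x / δ) = x := by field_simp
    unfold smoothFloor
    linear_combination δ * Int.floor_add_fract (x / δ) + hx
  rw [h, abs_mul, abs_of_pos hδ]
  exact mul_le_of_le_one_right hδ.le (abs_le.2 ⟨by linarith, by linarith⟩)

theorem tendsto_smoothFloor (δ x : ℝ) :
    Tendsto (fun n => smoothFloor δ n x) atTop (𝓝 (δ * ⌊x / δ⌋)) := by
  have h := (tendsto_pow_atTop_nhds_zero_of_lt_one (Int.fract_nonneg (x / δ))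
    (Int.fract_lt_one (x / δ))).comp (tendsto_add_atTop_nat 1)
  simpa [smoothFloor, Function.comp_def] using (h.const_add (⌊x / δ⌋ : ℝ)).const_mul δ

/-- The lattice point `δ ⌊x / δ⌋`, coordinatewise. -/
noncomputable def gridPoint {d : ℕ} (δ : ℝ) (x : Fin d → ℝ) : Fin d → ℝ :=
  fun i => δ * ⌊x i / δ⌋

theorem dist_gridPoint_le {d : ℕ} {δ : ℝ} (hδ : 0 < δ) (x : Fin d → ℝ) :
    dist (gridPoint δ x) x ≤ δ := by
  refine (dist_pi_le_iff hδ.le).2 fun i => ?_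
  exact le_of_tendsto ((tendsto_smoothFloor δ (x i)).dist tendsto_const_nhds)
    (Eventually.of_forall fun n => abs_smoothFloor_sub_le hδ n (x i))

theorem finite_gridPoint_image {d : ℕ} {δ : ℝ} (hδ : 0 < δ) {K : Set (Fin d → ℝ)}
    (hK : Bornology.IsBounded K) : (gridPoint δ '' K).Finite := by
  obtain ⟨R, hR⟩ := hK.exists_norm_le
  refine ((finite_Icc (fun _ : Fin d => ⌊-R / δ⌋) (fun _ => ⌊R / δ⌋)).image
    (fun J i => δ * (J i : ℝ))).subset ?_
  rintro _ ⟨x, hx, rfl⟩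
  refine ⟨fun i => ⌊x i / δ⌋, ⟨fun i => ?_, fun i => ?_⟩, rfl⟩
  all_goals
    have h := abs_le.1 ((norm_le_pi_norm x i).trans (hR x hx))
    refine Int.floor_mono ?_
    gcongr
  exacts [h.1, h.2]

/-- Dominated convergence for `eLpNorm`, with a constant bound on a finite measure space. -/
theorem tendsto_eLpNorm_of_bounded {α E : Type*} [MeasurableSpace α] {μ : Measure α}
    [IsFiniteMeasure μ] [NormedAddCommGroup E] {p : ENNReal} (hp : p ≠ 0) (hp' : p ≠ ⊤)
    {u : ℕ → α → E} {v : α → E} {C : ℝ} (hu : ∀ n, AEStronglyMeasurable (u n) μ)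
    (hC : ∀ n, ∀ᵐ x ∂μ, ‖u n x‖ ≤ C)
    (hlim : ∀ᵐ x ∂μ, Tendsto (fun n => u n x) atTop (𝓝 (v x))) :
    Tendsto (fun n => eLpNorm (u n) p μ) atTop (𝓝 (eLpNorm v p μ)) := by
  simp only [eLpNorm_eq_lintegral_rpow_enorm_toReal hp hp']
  refine (ENNReal.continuous_rpow_const.tendsto _).comp ?_
  refine tendsto_lintegral_of_dominated_convergence' (fun _ => ENNReal.ofReal C ^ p.toReal)
    (fun n => (hu n).enorm.pow_const _) (fun n => ?_) ?_ ?_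
  · filter_upwards [hC n] with x hx
    gcongr
    rw [← ofReal_norm]
    exact ENNReal.ofReal_le_ofReal hx
  · rw [lintegral_const]
    exact ENNReal.mul_ne_top (by finiteness) (measure_ne_top _ _)
  · filter_upwards [hlim] with x hx
    exact (ENNReal.continuous_rpow_const.tendsto _).comp hx.enorm

/-- Proposition 3.6: approximate UIP together with the ability to approximate all
componentwise increasing maps `(h(x₁),…,h(x_d))` uniformly on compacts implies the
UAP in the `L^p` sense for all `1 ≤ p < ∞`.
(Recall that the norm on `Fin d → ℝ` is the sup norm `‖·‖_∞`.) -/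
theorem uap_of_uip_and_shrinking {d : ℕ} (hd : 2 ≤ d)
    (F : Set ((Fin d → ℝ) → (Fin d → ℝ)))
    (hLip : ∀ f ∈ F, ∃ L : NNReal, LipschitzWith L f)
    (hUIP : ∀ ε : ℝ, 0 < ε → ∀ (N : ℕ) (x y : Fin N → (Fin d → ℝ)),
      Function.Injective x → Function.Injective y →
      ∃ φ ∈ Attainable F, ∀ i, ‖φ (x i) - y i‖ ≤ ε)
    (hShrink : ∀ K : Set (Fin d → ℝ), IsCompact K →
      ∀ h : ℝ → ℝ, Monotone h → Continuous h →
      ∀ ε : ℝ, 0 < ε →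
      ∃ φ ∈ Attainable F,
        sSup ((fun x => ‖φ x - fun i => h (x i)‖) '' K) < ε)
    (p : ℝ) (hp : 1 ≤ p) :
    ∀ (G : (Fin d → ℝ) → (Fin d → ℝ)), Continuous G →
      ∀ (K : Set (Fin d → ℝ)), IsCompact K →
        ∀ ε : ℝ, 0 < ε →
          ∃ φ ∈ Attainable F,
            eLpNorm (fun x => G x - φ x) (ENNReal.ofReal p) (volume.restrict K)
              < ENNReal.ofReal ε := by
  intro G hG K hK ε hε
  have : Nonempty (Fin d) := ⟨⟨0, by omega⟩⟩
  have : IsFiniteMeasure (volume.restrict K) := ⟨by simpa using hK.measure_lt_top⟩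
  have hp0 : ENNReal.ofReal p ≠ 0 := by simpa using zero_lt_one.trans_le hp
  obtain ⟨η, hη, hηε⟩ : ∃ η : ℝ, 0 < η ∧
      (volume.restrict K) univ ^ (ENNReal.ofReal p).toReal⁻¹ * ENNReal.ofReal (3 * η)
        < ENNReal.ofReal ε := by
    have hm : (volume.restrict K) univ ^ (ENNReal.ofReal p).toReal⁻¹ ≠ ⊤ :=
      ENNReal.rpow_ne_top_of_nonneg (by positivity) (measure_ne_top _ _)
    set m := (volume.restrict K) univ ^ (ENNReal.ofReal p).toReal⁻¹
    have hm0 : 0 ≤ m.toReal := ENNReal.toReal_nonneg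
    refine ⟨ε / (3 * (m.toReal + 1)), by positivity, ?_⟩
    rw [← ENNReal.ofReal_toReal hm, ← ENNReal.ofReal_mul hm0,
      ENNReal.ofReal_lt_ofReal_iff hε, ENNReal.toReal_ofReal hm0]
    rw [show m.toReal * (3 * (ε / (3 * (m.toReal + 1)))) = ε * (m.toReal / (m.toReal + 1)) by
      field_simp]
    exact mul_lt_of_lt_one_right hε ((div_lt_one (by positivity)).2 (by linarith))
  obtain ⟨R, hR⟩ := hK.isBounded.exists_norm_le
  obtain ⟨δ, hδ, hδ1, hGδ⟩ : ∃ δ : ℝ, 0 < δ ∧ δ ≤ 1 ∧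
      ∀ x ∈ K, dist (G x) (G (gridPoint δ x)) ≤ η := by
    obtain ⟨δ, hδ, h⟩ := Metric.uniformContinuousOn_iff_le.1
      ((isCompact_closedBall (0 : Fin d → ℝ) (R + 1)).uniformContinuousOn_of_continuous
        hG.continuousOn) η hη
    have hδ' : 0 < min δ 1 := lt_min hδ one_pos
    refine ⟨min δ 1, hδ', min_le_right _ _, fun x hx => ?_⟩
    have hd := dist_gridPoint_le hδ' x
    have hx0 : dist x 0 ≤ R := by simpa using hR x hx
    refine h x ?_ _ ?_ ?_
    · exact Metric.mem_closedBall.2 (by linarith)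
    · exact Metric.mem_closedBall.2 ((dist_triangle _ x 0).trans
        (by linarith [min_le_right δ 1]))
    · rw [dist_comm]
      exact hd.trans (min_le_left _ _)
  obtain ⟨ψ, hψ, hψη⟩ : ∃ ψ ∈ Attainable F, ∀ x ∈ K,
      dist (G (gridPoint δ x)) (ψ (gridPoint δ x)) ≤ 2 * η := by
    have hfin := finite_gridPoint_image hδ hK.isBounded
    have := hfin.fintype
    let e := (Fintype.equivFin (gridPoint δ '' K)).symm
    obtain ⟨y, hy, hyG⟩ := exists_injective_dist_le (fun j => G (e j)) hη
    obtain ⟨ψ, hψ, h⟩ := hUIP η hη _ (fun j => (e j : Fin d → ℝ)) y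
      (Subtype.val_injective.comp e.injective) hy
    refine ⟨ψ, hψ, fun x hx => ?_⟩
    obtain ⟨j, hj⟩ := e.surjective ⟨gridPoint δ x, mem_image_of_mem _ hx⟩
    have h1 := hyG j
    have h2 := h j
    rw [← dist_eq_norm] at h2
    simp only [hj] at h1 h2
    rw [dist_comm] at h1 h2
    linarith [dist_triangle (G (gridPoint δ x)) (y j) (ψ (gridPoint δ x))]
  have hψc := Attainable.continuous hLip hψ
  choose σ hσ hσs using fun n : ℕ => hShrink K hK (smoothFloor δ n)
    (smoothFloor_monotone hδ n) (smoothFloor_continuous δ n) (1 / ((n : ℝ) + 1)) (by positivity)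
  have hσc := fun n => Attainable.continuous hLip (hσ n)
  have hσd : ∀ n, ∀ x ∈ K, dist (σ n x) (fun i => smoothFloor δ n (x i)) ≤ 1 / ((n : ℝ) + 1) := by
    intro n x hx
    have hc : Continuous fun x : Fin d → ℝ => ‖σ n x - fun i => smoothFloor δ n (x i)‖ :=
      ((hσc n).sub (continuous_pi fun i =>
        (smoothFloor_continuous δ n).comp (continuous_apply i))).norm
    rw [dist_eq_norm]
    exact (le_csSup (hK.image hc).bddAbove (mem_image_of_mem _ hx)).trans (hσs n).le
  have hσR : ∀ n, ∀ x ∈ K, σ n x ∈ Metric.closedBall (0 : Fin d → ℝ) (R + 2) := by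
    intro n x hx
    have h1 : dist (fun i => smoothFloor δ n (x i)) x ≤ δ :=
      (dist_pi_le_iff hδ.le).2 fun i => abs_smoothFloor_sub_le hδ n (x i)
    have h2 : dist x 0 ≤ R := by simpa using hR x hx
    have h3 : 1 / ((n : ℝ) + 1) ≤ 1 := by
      rw [div_le_one (by positivity)]
      linarith [n.cast_nonneg (α := ℝ)]
    have h4 := hσd n x hx
    exact Metric.mem_closedBall.2 ((dist_triangle4 _ _ x 0).trans (by linarith))
  have hlim : ∀ x ∈ K, Tendsto (fun n => σ n x) atTop (𝓝 (gridPoint δ x)) := by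
    intro x hx
    refine (tendsto_iff_of_dist ?_).2
      (tendsto_pi_nhds.2 fun i => tendsto_smoothFloor δ (x i))
    exact squeeze_zero (fun _ => dist_nonneg) (fun n => hσd n x hx)
      tendsto_one_div_add_atTop_nhds_zero_nat
  obtain ⟨A, hA⟩ := hK.exists_bound_of_continuousOn hG.continuousOn
  obtain ⟨B, hB⟩ := (isCompact_closedBall (0 : Fin d → ℝ) (R + 2)).exists_bound_of_continuousOn
    hψc.continuousOn
  have hconv := tendsto_eLpNorm_of_bounded (μ := volume.restrict K) hp0 ENNReal.ofReal_ne_top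
    (u := fun n x => G x - (ψ ∘ σ n) x) (v := fun x => G x - ψ (gridPoint δ x)) (C := A + B)
    (fun n => (hG.sub (hψc.comp (hσc n))).aestronglyMeasurable)
    (fun n => by
      filter_upwards [ae_restrict_mem hK.measurableSet] with x hx
      exact (norm_sub_le _ _).trans (add_le_add (hA x hx) (hB _ (hσR n x hx))))
    (by
      filter_upwards [ae_restrict_mem hK.measurableSet] with x hx
      exact tendsto_const_nhds.sub ((hψc.tendsto _).comp (hlim x hx)))
  have hbound : eLpNorm (fun x => G x - ψ (gridPoint δ x)) (ENNReal.ofReal p)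
      (volume.restrict K) < ENNReal.ofReal ε := by
    refine lt_of_le_of_lt (eLpNorm_le_of_ae_bound ?_) hηε
    filter_upwards [ae_restrict_mem hK.measurableSet] with x hx
    rw [← dist_eq_norm]
    linarith [dist_triangle (G x) (G (gridPoint δ x)) (ψ (gridPoint δ x)), hGδ x hx, hψη x hx]
  obtain ⟨n, hn⟩ := (hconv.eventually_lt_const hbound).exists
  exact ⟨ψ ∘ σ n, Attainable.comp hψ (hσ n), hn⟩
end
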